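/- arXiv:1612.04713 — 2 statements merged into one kernel-verified Lean document; each statement's English description precedes it below -/
import Mathlib

section
/- With a supermetric and graded Heisenberg algebra as in the context, define M_{ab} := x_a ∂_b − ε(−1)^{[a][b]+[a]+[b]} x_b ∂_a and the mixed-index matrix M^a_b := Σ_c ε̄^{ac} M_{cb}, with matrix powers (M²)^a_b := Σ_c M^a_c M^c_b, (M³)^a_b := Σ_c (M²)^a_c M^c_b, and S := Σ_c (−1)^{[c]} (M²)^c_c. Then the cubic characteristic identity holds: for all a, d ∈ I, (M³)^a_d = (ω − 1)·(M²)^a_d + (2 − ω)·M^a_d + (ε/2)·M^a_d·S − (ε/2)·δ^a_d·S. -/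
/-- The sign (−1)^x for a parity x ∈ ZMod 2. -/
noncomputable def sg (x : ZMod 2) : ℂ := if x = 0 then 1 else -1

/-- Generators `x`, `d` of a Heisenberg algebra whose commutation signs are governed by a symmetric
matrix `κ` of signs, with metric `g` and inverse metric `h`, both compatible with `κ`. -/
structure ColorHeisenberg {ι A : Type*} [Fintype ι] [DecidableEq ι] [Ring A] [Algebra ℂ A]
    (κ g h : ι → ι → ℂ) (x d : ι → A) : Prop where
  sign_symm : ∀ a b, κ a b = κ b a
  sign_mul_self : ∀ a b, κ a b * κ a b = 1
  metric_symm : ∀ a b, g a b = κ a b * g b a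
  inv_symm : ∀ a b, h a b = κ a b * h b a
  sign_eq : ∀ a b, h a b ≠ 0 → ∀ c, κ a c = κ b c
  inv_metric : ∀ a c, ∑ b, h a b * g b c = if a = c then 1 else 0
  metric_inv : ∀ a c, ∑ b, g a b * h b c = if a = c then 1 else 0
  x_mul_x : ∀ a b, x a * x b = κ a b • (x b * x a)
  d_mul_d : ∀ a b, d a * d b = κ a b • (d b * d a)
  d_mul_x : ∀ a b, d a * x b = κ a b • (x b * d a) + g a b • (1 : A)

namespace ColorHeisenberg

variable {ι A : Type*} [Fintype ι] [Ring A] [Algebra ℂ A]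
  {κ g h : ι → ι → ℂ} {x d : ι → A}

/-- Raising an index with the inverse metric `h`. -/
def raise (h : ι → ι → ℂ) (y : ι → A) (a : ι) : A := ∑ b, h a b • y b

/-- The quadratic contraction `∑ y_a z^a`. -/
def contract (h : ι → ι → ℂ) (y z : ι → A) : A := ∑ a, y a * raise h z a

/-- The mixed-index generators `x^a ∂_b - κ_{ab} x_b ∂^a`. -/
def gen (κ h : ι → ι → ℂ) (x d : ι → A) (a b : ι) : A :=
  raise h x a * d b - κ a b • (x b * raise h d a)

/-- The entries of the square of the matrix of generators. -/
def genSq (κ h : ι → ι → ℂ) (x d : ι → A) (a b : ι) : A :=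
  ∑ c, gen κ h x d a c * gen κ h x d c b

/-- The graded dimension `∑ h^{ab} g_{ab}` of the metric. -/
def dim (g h : ι → ι → ℂ) : ℂ := ∑ a, ∑ b, h a b * g a b

theorem raise_zero (a : ι) : raise h (fun _ => (0 : A)) a = 0 := by simp [raise]

theorem mul_raise_of_mul {y z : ι → A} {t : A} {k : ℂ} (ht : ∀ c, t * y c = y c * t + k • z c)
    (a : ι) : t * raise h y a = raise h y a * t + k • raise h z a := by
  simp only [raise, Finset.sum_mul, Finset.mul_sum, Finset.smul_sum, ← Finset.sum_add_distrib]
  refine Finset.sum_congr rfl fun c _ => ?_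
  rw [mul_smul_comm, ht, smul_mul_assoc]
  module

theorem gen_commute {t : A} {k l : ℂ} {z w : ι → A}
    (hx : ∀ c, t * x c = x c * t + k • z c) (hd : ∀ c, t * d c = d c * t + l • w c)
    (hzw : ∀ a b, k • (raise h z a * d b) + l • (raise h x a * w b) =
      κ a b • (k • (z b * raise h d a) + l • (x b * raise h w a))) (a b : ι) :
    t * gen κ h x d a b = gen κ h x d a b * t := by
  have e1 : t * (raise h x a * d b) = raise h x a * d b * t + k • (raise h z a * d b) +
      l • (raise h x a * w b) := by
    rw [← mul_assoc, mul_raise_of_mul hx, add_mul, mul_assoc, hd, mul_add, mul_smul_comm,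
      smul_mul_assoc, mul_assoc]
    module
  have e2 : t * (x b * raise h d a) = x b * raise h d a * t + (k • (z b * raise h d a) +
      l • (x b * raise h w a)) := by
    rw [← mul_assoc, hx, add_mul, mul_assoc, mul_raise_of_mul hd, mul_add, mul_smul_comm,
      smul_mul_assoc, mul_assoc]
    module
  rw [gen, mul_sub, sub_mul, mul_smul_comm, smul_mul_assoc, e1, e2, smul_add, ← hzw]
  module

variable [DecidableEq ι]

theorem inv_mul_sign (H : ColorHeisenberg κ g h x d) (a b c : ι) :
    h a b * κ b c = h a b * κ a c := by
  by_cases hab : h a b = 0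
  · simp [hab]
  · rw [H.sign_eq a b hab]

theorem raise_mul (H : ColorHeisenberg κ g h x d) {y f : ι → A} {z : A} {b : ι}
    (hy : ∀ c, y c * z = κ c b • (z * y c) + f c) (a : ι) :
    raise h y a * z = κ a b • (z * raise h y a) + raise h f a := by
  simp only [raise, Finset.sum_mul, Finset.mul_sum, Finset.smul_sum, ← Finset.sum_add_distrib]
  refine Finset.sum_congr rfl fun c _ => ?_
  rw [smul_mul_assoc, hy, mul_smul_comm, smul_add, smul_smul, smul_smul, H.inv_mul_sign, mul_comm]

theorem raise_mul_of_comm (H : ColorHeisenberg κ g h x d) {y : ι → A} {z : A} {b : ι}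
    (hy : ∀ c, y c * z = κ c b • (z * y c)) (a : ι) :
    raise h y a * z = κ a b • (z * raise h y a) := by
  have := H.raise_mul (y := y) (f := fun _ => 0) (z := z) (b := b) (by simpa using hy) a
  rwa [raise_zero, add_zero] at this

theorem mul_swap (H : ColorHeisenberg κ g h x d) {y z f : A} {a b : ι}
    (hy : y * z = κ a b • (z * y) + f) : z * y = κ b a • (y * z) - κ a b • f := by
  rw [hy, smul_add, smul_smul, H.sign_symm b a, H.sign_mul_self]
  module

theorem raise_x_mul_x (H : ColorHeisenberg κ g h x d) (a b : ι) :
    raise h x a * x b = κ a b • (x b * raise h x a) :=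
  H.raise_mul_of_comm (fun c => H.x_mul_x c b) a

theorem raise_d_mul_d (H : ColorHeisenberg κ g h x d) (a b : ι) :
    raise h d a * d b = κ a b • (d b * raise h d a) :=
  H.raise_mul_of_comm (fun c => H.d_mul_d c b) a

theorem x_mul_raise_x (H : ColorHeisenberg κ g h x d) (a b : ι) :
    x a * raise h x b = κ a b • (raise h x b * x a) := by
  rw [H.raise_x_mul_x, smul_smul, H.sign_symm b a, H.sign_mul_self, one_smul]

theorem d_mul_raise_d (H : ColorHeisenberg κ g h x d) (a b : ι) :
    d a * raise h d b = κ a b • (raise h d b * d a) := by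
  rw [H.raise_d_mul_d, smul_smul, H.sign_symm b a, H.sign_mul_self, one_smul]

theorem raise_d_mul_raise_d (H : ColorHeisenberg κ g h x d) (a b : ι) :
    raise h d a * raise h d b = κ a b • (raise h d b * raise h d a) :=
  H.raise_mul_of_comm (fun c => H.d_mul_raise_d c b) a

theorem raise_d_mul_x (H : ColorHeisenberg κ g h x d) (a b : ι) :
    raise h d a * x b = κ a b • (x b * raise h d a) + (if a = b then (1 : ℂ) else 0) • (1 : A) := by
  rw [H.raise_mul (f := fun c => g c b • (1 : A)) (fun c => H.d_mul_x c b) a]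
  simp only [raise, smul_smul, ← Finset.sum_smul, H.inv_metric]

theorem d_mul_raise_x (H : ColorHeisenberg κ g h x d) (a b : ι) :
    d a * raise h x b = κ a b • (raise h x b * d a) +
      (κ a b * if a = b then 1 else 0) • (1 : A) := by
  have := H.raise_mul (y := x) (z := d a) (b := a) (f := fun c => (-(g c a)) • (1 : A))
    (fun c => by
      rw [H.mul_swap (H.d_mul_x a c), smul_smul, ← H.sign_symm c a, ← H.metric_symm]; module) b
  rw [this]
  simp only [raise, smul_smul, ← Finset.sum_smul, mul_neg, Finset.sum_neg_distrib, H.inv_metric]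
  rw [smul_add, smul_smul, H.sign_symm b a, H.sign_mul_self]
  simp only [eq_comm (a := b)]
  module

theorem raise_d_mul_raise_x (H : ColorHeisenberg κ g h x d) (a b : ι) :
    raise h d a * raise h x b = κ a b • (raise h x b * raise h d a) + h b a • (1 : A) := by
  rw [H.raise_mul (y := d) (f := fun c => (κ c b * if c = b then 1 else 0) • (1 : A))
    (fun c => H.d_mul_raise_x c b) a]
  simp only [raise, smul_smul, ← Finset.sum_smul, ← mul_assoc, H.inv_mul_sign]
  simp [H.inv_symm b a, H.sign_symm b a, mul_comm]

theorem sum_metric_smul_raise (H : ColorHeisenberg κ g h x d) (y : ι → A) (a : ι) :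
    ∑ b, g a b • raise h y b = y a := by
  simp only [raise, Finset.smul_sum, smul_smul]
  rw [Finset.sum_comm]
  simp only [← Finset.sum_smul, H.metric_inv]
  simp

theorem sum_sign_smul_raise_mul (H : ColorHeisenberg κ g h x d) (y z : ι → A) :
    ∑ a, κ a a • (raise h y a * z a) = contract h y z := by
  simp only [contract, raise, Finset.smul_sum, Finset.mul_sum, Finset.sum_mul]
  rw [Finset.sum_comm]
  refine Finset.sum_congr rfl fun b _ => Finset.sum_congr rfl fun a _ => ?_
  rw [smul_mul_assoc, smul_smul, mul_smul_comm, H.inv_symm b a, mul_comm (κ a a),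
    ← H.inv_mul_sign, mul_comm]

theorem sum_d_mul_raise_x (H : ColorHeisenberg κ g h x d) :
    ∑ a, d a * raise h x a = contract h x d + dim g h • (1 : A) := by
  simp only [contract, dim, raise, Finset.mul_sum, Finset.sum_smul]
  rw [Finset.sum_comm (f := fun a i => x a * h a i • d i)]
  simp only [← Finset.sum_add_distrib]
  refine Finset.sum_congr rfl fun a _ => Finset.sum_congr rfl fun b _ => ?_
  rw [mul_smul_comm, H.d_mul_x, mul_smul_comm, smul_add, smul_smul, smul_smul]
  rw [H.inv_symm b a, H.sign_symm b a, mul_comm (κ a b)]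

theorem dim_eq (H : ColorHeisenberg κ g h x d) : dim g h = ∑ a, κ a a := by
  simp only [dim]
  refine Finset.sum_congr rfl fun a _ => ?_
  have : ∀ b, h a b * g a b = κ a a * (h a b * g b a) := fun b => by
    rw [H.metric_symm a b, H.sign_symm a b, ← mul_assoc, H.inv_mul_sign]; ring
  simp [this, ← Finset.mul_sum, H.inv_metric]

theorem number_mul_x (H : ColorHeisenberg κ g h x d) (b : ι) :
    contract h x d * x b = x b * contract h x d + (1 : ℂ) • x b := by
  have : ∀ c, x c * raise h d c * x b = x b * (x c * raise h d c) +
      (if c = b then (1 : ℂ) else 0) • x c := fun c => by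
    rw [mul_assoc, H.raise_d_mul_x, mul_add, mul_smul_comm, ← mul_assoc, H.x_mul_x c b,
      smul_mul_assoc, smul_smul, H.sign_mul_self, mul_smul_comm, mul_one, one_smul, mul_assoc]
  simp [contract, Finset.sum_mul, this, Finset.sum_add_distrib, Finset.mul_sum]

theorem number_mul_d (H : ColorHeisenberg κ g h x d) (b : ι) :
    contract h x d * d b = d b * contract h x d + (-1 : ℂ) • d b := by
  have : ∀ c, d b * (x c * raise h d c) = x c * raise h d c * d b + g b c • raise h d c :=
      fun c => by
    rw [← mul_assoc, H.d_mul_x, add_mul, smul_mul_assoc, mul_assoc, H.d_mul_raise_d, mul_smul_comm,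
      smul_smul, H.sign_mul_self, smul_mul_assoc, one_mul, one_smul, mul_assoc]
  have h2 : d b * contract h x d = contract h x d * d b + d b := by
    simp [contract, Finset.sum_mul, this, Finset.sum_add_distrib, Finset.mul_sum,
      H.sum_metric_smul_raise]
  rw [h2]; module

theorem contract_x_mul_x (H : ColorHeisenberg κ g h x d) (b : ι) :
    contract h x x * x b = x b * contract h x x := by
  simp only [contract, Finset.sum_mul, Finset.mul_sum]
  refine Finset.sum_congr rfl fun c _ => ?_
  rw [mul_assoc, H.raise_x_mul_x, mul_smul_comm, ← mul_assoc, H.x_mul_x c b, smul_mul_assoc,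
    smul_smul, H.sign_mul_self, one_smul, mul_assoc]

theorem contract_x_mul_d (H : ColorHeisenberg κ g h x d) (b : ι) :
    contract h x x * d b = d b * contract h x x + (-2 : ℂ) • x b := by
  have : ∀ c, d b * (x c * raise h x c) = x c * raise h x c * d b +
      (if b = c then (1 : ℂ) else 0) • x c + g b c • raise h x c := fun c => by
    rw [← mul_assoc, H.d_mul_x, add_mul, smul_mul_assoc, mul_assoc, H.d_mul_raise_x, mul_add,
      mul_smul_comm, mul_smul_comm, mul_one, smul_add, smul_smul, smul_smul, ← mul_assoc (κ b c),
      H.sign_mul_self, smul_mul_assoc, one_mul, one_mul, one_smul, mul_assoc]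
  have h2 : d b * contract h x x = contract h x x * d b + x b + x b := by
    simp [contract, Finset.sum_mul, this, Finset.sum_add_distrib, Finset.mul_sum,
      H.sum_metric_smul_raise]
  rw [h2]; module

theorem contract_d_mul_d (H : ColorHeisenberg κ g h x d) (b : ι) :
    contract h d d * d b = d b * contract h d d := by
  simp only [contract, Finset.sum_mul, Finset.mul_sum]
  refine Finset.sum_congr rfl fun c _ => ?_
  rw [mul_assoc, H.raise_d_mul_d, mul_smul_comm, ← mul_assoc, H.d_mul_d c b, smul_mul_assoc,
    smul_smul, H.sign_mul_self, one_smul, mul_assoc]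

theorem contract_d_mul_x (H : ColorHeisenberg κ g h x d) (b : ι) :
    contract h d d * x b = x b * contract h d d + (2 : ℂ) • d b := by
  have : ∀ c, d c * raise h d c * x b = x b * (d c * raise h d c) + g b c • raise h d c +
      (if c = b then (1 : ℂ) else 0) • d c := fun c => by
    rw [mul_assoc, H.raise_d_mul_x, mul_add, mul_smul_comm, ← mul_assoc, H.d_mul_x c b, add_mul,
      smul_add, smul_mul_assoc, smul_smul, H.sign_mul_self, mul_smul_comm, mul_one, one_smul,
      smul_mul_assoc, one_mul, smul_smul, H.sign_symm c b, ← H.metric_symm, mul_assoc]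
  have h2 : contract h d d * x b = x b * contract h d d + d b + d b := by
    simp [contract, Finset.sum_mul, this, Finset.sum_add_distrib, Finset.mul_sum,
      H.sum_metric_smul_raise]
  rw [h2]; module

theorem number_mul_gen (H : ColorHeisenberg κ g h x d) (a b : ι) :
    contract h x d * gen κ h x d a b = gen κ h x d a b * contract h x d :=
  gen_commute H.number_mul_x H.number_mul_d (fun a b => by module) a b

theorem contract_x_mul_gen (H : ColorHeisenberg κ g h x d) (a b : ι) :
    contract h x x * gen κ h x d a b = gen κ h x d a b * contract h x x :=
  gen_commute (k := 0) (z := x) (fun c => by rw [H.contract_x_mul_x]; module) H.contract_x_mul_d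
    (fun a b => by rw [H.raise_x_mul_x]; module) a b

theorem contract_d_mul_gen (H : ColorHeisenberg κ g h x d) (a b : ι) :
    contract h d d * gen κ h x d a b = gen κ h x d a b * contract h d d :=
  gen_commute (l := 0) (w := d) H.contract_d_mul_x (fun c => by rw [H.contract_d_mul_d]; module)
    (fun a b => by rw [H.raise_d_mul_d]; module) a b

theorem sum_x_mul_gen (H : ColorHeisenberg κ g h x d) (b : ι) :
    ∑ c, x c * gen κ h x d c b = contract h x x * d b - x b * contract h x d := by
  have : ∀ c, x c * gen κ h x d c b = x c * raise h x c * d b - x b * (x c * raise h d c) :=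
      fun c => by
    rw [gen, mul_sub, mul_smul_comm, ← mul_assoc, ← mul_assoc, H.x_mul_x c b, smul_mul_assoc,
      smul_smul, H.sign_mul_self, one_smul, mul_assoc (x b)]
  simp only [this, Finset.sum_sub_distrib, ← Finset.sum_mul, ← Finset.mul_sum, contract]

theorem sum_d_mul_gen (H : ColorHeisenberg κ g h x d) (b : ι) :
    ∑ c, d c * gen κ h x d c b = contract h x d * d b + (dim g h - 1) • d b -
      x b * contract h d d := by
  have : ∀ c, d c * gen κ h x d c b = d c * raise h x c * d b - x b * (d c * raise h d c) -
      g b c • raise h d c := fun c => by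
    rw [gen, mul_sub, mul_smul_comm, ← mul_assoc, ← mul_assoc, H.d_mul_x c b, add_mul, smul_add,
      smul_mul_assoc, smul_smul, H.sign_mul_self, smul_mul_assoc, one_mul, one_smul, smul_smul,
      H.sign_symm c b, ← H.metric_symm, mul_assoc (x b)]
    abel
  simp only [this, Finset.sum_sub_distrib, ← Finset.sum_mul, ← Finset.mul_sum, H.sum_d_mul_raise_x,
    H.sum_metric_smul_raise, add_mul, smul_mul_assoc, one_mul, contract]
  module

theorem raise_d_mul_gen (H : ColorHeisenberg κ g h x d) (a b c : ι) :
    raise h d a * gen κ h x d c b = (κ a c * κ a b) • (gen κ h x d c b * raise h d a) +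
      h c a • d b - (κ a c * if a = b then 1 else 0) • raise h d c := by
  have e1 : raise h d a * (raise h x c * d b) =
      (κ a c * κ a b) • (raise h x c * d b * raise h d a) + h c a • d b := by
    rw [← mul_assoc, H.raise_d_mul_raise_x, add_mul, smul_mul_assoc, mul_assoc, H.raise_d_mul_d,
      mul_smul_comm, smul_smul, smul_mul_assoc, one_mul, mul_assoc]
  have e2 : raise h d a * (x b * raise h d c) =
      (κ a c * κ a b) • (x b * raise h d c * raise h d a) +
        (if a = b then (1 : ℂ) else 0) • raise h d c := by
    rw [← mul_assoc, H.raise_d_mul_x, add_mul, smul_mul_assoc, mul_assoc, H.raise_d_mul_raise_d,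
      mul_smul_comm, smul_smul, smul_mul_assoc, one_mul, mul_assoc, mul_comm (κ a b)]
  rw [gen, mul_sub, mul_smul_comm, e1, e2, sub_mul, smul_mul_assoc]
  by_cases hab : a = b
  · subst hab
    simp only [if_true, H.sign_symm c a]
    module
  · simp only [if_neg hab]
    module

theorem sum_sign_smul_x_mul_raise_d_mul_gen (H : ColorHeisenberg κ g h x d) (a b : ι) :
    ∑ c, κ a c • (x c * raise h d a * gen κ h x d c b) =
      κ a b • ((contract h x x * d b - x b * contract h x d) * raise h d a) +
        raise h x a * d b - (if a = b then (1 : ℂ) else 0) • contract h x d := by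
  have : ∀ c, κ a c • (x c * raise h d a * gen κ h x d c b) =
      κ a b • (x c * gen κ h x d c b * raise h d a) + h a c • x c * d b -
        (if a = b then (1 : ℂ) else 0) • (x c * raise h d c) := fun c => by
    rw [mul_assoc, H.raise_d_mul_gen, mul_sub, mul_add, mul_smul_comm, mul_smul_comm, mul_smul_comm,
      smul_sub, smul_add, smul_smul, smul_smul, smul_smul, ← mul_assoc (κ a c), ← mul_assoc (κ a c),
      H.sign_mul_self, one_mul, one_mul, ← H.inv_symm, smul_mul_assoc, mul_assoc]
  simp only [this, Finset.sum_sub_distrib, Finset.sum_add_distrib, ← Finset.smul_sum,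
    ← Finset.sum_mul, H.sum_x_mul_gen]
  simp only [raise, contract]

theorem x_mul_number (H : ColorHeisenberg κ g h x d) (b : ι) :
    x b * contract h x d = contract h x d * x b - x b := by
  rw [H.number_mul_x]; module

theorem raise_x_mul_number (H : ColorHeisenberg κ g h x d) (b : ι) :
    raise h x b * contract h x d = contract h x d * raise h x b - raise h x b := by
  rw [mul_raise_of_mul H.number_mul_x]; module

theorem raise_d_mul_number (H : ColorHeisenberg κ g h x d) (b : ι) :
    raise h d b * contract h x d = contract h x d * raise h d b + raise h d b := by
  rw [mul_raise_of_mul H.number_mul_d]; module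

theorem raise_x_mul_contract_x (H : ColorHeisenberg κ g h x d) (b : ι) :
    raise h x b * contract h x x = contract h x x * raise h x b := by
  rw [mul_raise_of_mul (k := 0) (z := x) (fun c => by rw [H.contract_x_mul_x]; module)]; module

theorem contract_x_mul_number (H : ColorHeisenberg κ g h x d) :
    contract h x x * contract h x d =
      contract h x d * contract h x x - (2 : ℂ) • contract h x x := by
  have : ∀ c, x c * raise h x c * contract h x d =
      contract h x d * (x c * raise h x c) - (2 : ℂ) • (x c * raise h x c) := fun c => by
    rw [mul_assoc, H.raise_x_mul_number, mul_sub, ← mul_assoc, H.x_mul_number, sub_mul, mul_assoc]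
    module
  rw [contract.eq_def h x x, Finset.sum_mul, Finset.mul_sum, Finset.smul_sum,
    ← Finset.sum_sub_distrib]
  exact Finset.sum_congr rfl fun c _ => this c

theorem genSq_eq (H : ColorHeisenberg κ g h x d) (a b : ι) :
    genSq κ h x d a b = contract h x d * (raise h x a * d b) +
      (dim g h - 3) • (raise h x a * d b) + κ a b • (contract h x d * (x b * raise h d a)) -
      κ a b • (x b * raise h d a) - raise h x a * x b * contract h d d -
      contract h x x * (raise h d a * d b) + (if a = b then (1 : ℂ) else 0) • contract h x d := by
  have : ∀ c, gen κ h x d a c * gen κ h x d c b = raise h x a * (d c * gen κ h x d c b) -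
      κ a c • (x c * raise h d a * gen κ h x d c b) := fun c => by
    rw [gen.eq_def κ h x d a c, sub_mul, smul_mul_assoc, mul_assoc]
  simp only [genSq, this, Finset.sum_sub_distrib, ← Finset.mul_sum, H.sum_d_mul_gen,
    H.sum_sign_smul_x_mul_raise_d_mul_gen]
  simp only [mul_sub, mul_add, sub_mul, ← mul_assoc, H.raise_x_mul_number, mul_smul_comm,
    H.x_mul_number, smul_sub]
  have e : κ a b • (contract h x x * d b * raise h d a) = contract h x x * raise h d a * d b := by
    rw [mul_assoc, mul_assoc, H.raise_d_mul_d, mul_smul_comm]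
  rw [e]
  module

theorem trace_genSq (H : ColorHeisenberg κ g h x d) :
    ∑ a, κ a a • genSq κ h x d a a = (2 : ℂ) • (contract h x d * contract h x d +
      (dim g h - 2) • contract h x d - contract h x x * contract h d d) := by
  have : ∀ a, κ a a • genSq κ h x d a a = contract h x d * (κ a a • (raise h x a * d a)) +
      (dim g h - 3) • (κ a a • (raise h x a * d a)) + contract h x d * (x a * raise h d a) -
      x a * raise h d a - (κ a a • (raise h x a * x a)) * contract h d d -
      contract h x x * (κ a a • (raise h d a * d a)) + κ a a • contract h x d := fun a => by
    rw [H.genSq_eq, if_pos rfl]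
    simp only [smul_add, smul_sub, smul_smul, H.sign_mul_self, mul_smul_comm, smul_mul_assoc,
      one_smul]
    module
  simp only [this, Finset.sum_sub_distrib, Finset.sum_add_distrib, ← Finset.mul_sum,
    ← Finset.sum_mul, ← Finset.smul_sum, H.sum_sign_smul_raise_mul, ← Finset.sum_smul, ← H.dim_eq]
  rw [← contract]
  module

/-- The cubic characteristic identity for the matrix of generators. -/
theorem sum_genSq_mul_gen (H : ColorHeisenberg κ g h x d) {T : A}
    (hT : T = ∑ a, κ a a • genSq κ h x d a a) (a b : ι) :
    ∑ c, genSq κ h x d a c * gen κ h x d c b = (dim g h - 1) • genSq κ h x d a b +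
      (2 - dim g h) • gen κ h x d a b + (1 / 2 : ℂ) • (gen κ h x d a b * T) -
      (1 / 2 : ℂ) • (if a = b then T else 0) := by
  have term : ∀ c, genSq κ h x d a c * gen κ h x d c b =
      (contract h x d * raise h x a + (dim g h - 3) • raise h x a -
        contract h x x * raise h d a) * (d c * gen κ h x d c b) +
      (contract h x d - 1) * (κ a c • (x c * raise h d a * gen κ h x d c b)) -
      raise h x a * (x c * gen κ h x d c b) * contract h d d +
      contract h x d * (if a = c then gen κ h x d c b else 0) := fun c => by
    have e : raise h x a * x c * contract h d d * gen κ h x d c b =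
        raise h x a * (x c * gen κ h x d c b) * contract h d d := by
      simp only [mul_assoc, H.contract_d_mul_gen]
    rw [H.genSq_eq]
    simp only [add_mul, sub_mul, e]
    simp only [ite_smul, one_smul, zero_smul, ite_mul, zero_mul, mul_ite, mul_zero, smul_mul_assoc,
      mul_smul_comm, one_mul, mul_assoc]
    module
  have cT : gen κ h x d a b * T = T * gen κ h x d a b := by
    rw [hT, H.trace_genSq]
    simp only [mul_smul_comm, smul_mul_assoc, mul_add, add_mul, mul_sub, sub_mul, mul_assoc,
      H.contract_d_mul_gen, H.number_mul_gen]
    simp only [← mul_assoc, H.contract_x_mul_gen, H.number_mul_gen]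
  rw [cT]
  simp only [term, Finset.sum_sub_distrib, Finset.sum_add_distrib, ← Finset.mul_sum,
    ← Finset.sum_mul, H.sum_d_mul_gen, H.sum_sign_smul_x_mul_raise_d_mul_gen, H.sum_x_mul_gen,
    Finset.sum_ite_eq, Finset.mem_univ, if_true]
  have hδ : (if a = b then T else 0) = (if a = b then (1 : ℂ) else 0) • T := by
    simp only [ite_smul, one_smul, zero_smul]
  have hc : T * gen κ h x d a b = (2 : ℂ) • (contract h x d * (contract h x d * gen κ h x d a b) +
      (dim g h - 2) • (contract h x d * gen κ h x d a b) -
      contract h x x * (gen κ h x d a b * contract h d d)) := by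
    rw [hT, H.trace_genSq]
    simp only [smul_mul_assoc, add_mul, sub_mul, mul_assoc, H.contract_d_mul_gen]
  have e1 : ∀ t, raise h x a * (contract h x d * t) =
      contract h x d * (raise h x a * t) - raise h x a * t := fun t => by
    rw [← mul_assoc, H.raise_x_mul_number, sub_mul, mul_assoc]
  have e2 : ∀ t, raise h d a * (contract h x d * t) =
      contract h x d * (raise h d a * t) + raise h d a * t := fun t => by
    rw [← mul_assoc, H.raise_d_mul_number, add_mul, mul_assoc]
  have e3 : ∀ t, contract h x x * (contract h x d * t) =
      contract h x d * (contract h x x * t) - (2 : ℂ) • (contract h x x * t) := fun t => by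
    rw [← mul_assoc, H.contract_x_mul_number, sub_mul, smul_mul_assoc, mul_assoc]
  have e4 : ∀ t, raise h x a * (contract h x x * t) = contract h x x * (raise h x a * t) :=
    fun t => by rw [← mul_assoc, H.raise_x_mul_contract_x, mul_assoc]
  have e5 : ∀ t, raise h d a * (x b * t) = κ a b • (x b * (raise h d a * t)) +
      (if a = b then (1 : ℂ) else 0) • t := fun t => by
    rw [← mul_assoc, H.raise_d_mul_x, add_mul, smul_mul_assoc, smul_mul_assoc, one_mul, mul_assoc]
  have e6 : d b * raise h d a = κ a b • (raise h d a * d b) := by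
    rw [H.d_mul_raise_d, H.sign_symm]
  rw [hc, hδ, hT, H.trace_genSq, H.genSq_eq, gen]
  simp only [mul_add, add_mul, mul_sub, sub_mul, smul_mul_assoc, mul_smul_comm, mul_assoc, smul_add,
    smul_sub, e1, e2, e3, e4, e5, e6, one_mul, H.x_mul_number, smul_smul, ← H.contract_d_mul_d]
  match_scalars <;> first
    | ring1
    | linear_combination H.sign_mul_self a b
    | linear_combination -H.sign_mul_self a b

end ColorHeisenberg

theorem sg_add (u v : ZMod 2) : sg (u + v) = sg u * sg v := by
  have h2 : (1 + 1 : ZMod 2) = 0 := by decide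
  have h01 : ∀ w : ZMod 2, w = 0 ∨ w = 1 := by decide
  rcases h01 u with rfl | rfl <;> rcases h01 v with rfl | rfl <;> simp [sg, h2]

theorem sg_mul_self (u : ZMod 2) : sg u * sg u = 1 := by
  unfold sg; split_ifs <;> norm_num

theorem zmod_two_mul_self (u : ZMod 2) : u * u = u := by
  revert u; decide

theorem zmod_two_eq_of_add_eq_zero {u v : ZMod 2} (huv : u + v = 0) : u = v := by
  revert u v; decide

/-- The Jordan–Schwinger generators M_{ab} = x_a ∂_b − ε(−1)^{[a][b]+[a]+[b]} x_b ∂_a of osp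
built from a graded Heisenberg pair satisfy the cubic characteristic identity. -/
theorem jordan_schwinger_cubic_identity
    (n : ℕ) (p : Fin n → ZMod 2) (ε : ℂ) (hε : ε = 1 ∨ ε = -1)
    (εlo εhi : Matrix (Fin n) (Fin n) ℂ)
    (hlo0 : ∀ a b, p a + p b ≠ 0 → εlo a b = 0)
    (hhi0 : ∀ a b, p a + p b ≠ 0 → εhi a b = 0)
    (hlosym : ∀ a b, εlo a b = ε * sg (p a * p b) * εlo b a)
    (hhisym : ∀ a b, εhi a b = ε * sg (p a * p b) * εhi b a)
    (hinv1 : ∀ a c, (∑ b, εhi a b * εlo b c) = if a = c then 1 else 0)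
    (hinv2 : ∀ a c, (∑ b, εlo a b * εhi b c) = if a = c then 1 else 0)
    (A : Type*) [Ring A] [Algebra ℂ A] (x d : Fin n → A)
    (hxx : ∀ a b, x a * x b = (ε * sg (p a * p b)) • (x b * x a))
    (hdd : ∀ a b, d a * d b = (ε * sg (p a * p b)) • (d b * d a))
    (hdx : ∀ a b, d a * x b - (ε * sg (p a * p b)) • (x b * d a) = εlo a b • (1 : A)) :
    let ω : ℂ := ∑ a, ∑ b, εhi a b * εlo a b
    let Mlo : Fin n → Fin n → A := fun a b =>
      x a * d b - (ε * sg (p a * p b + p a + p b)) • (x b * d a)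
    let Mup : Fin n → Fin n → A := fun a b => ∑ cc, εhi a cc • Mlo cc b
    let M2 : Fin n → Fin n → A := fun a b => ∑ cc, Mup a cc * Mup cc b
    let M3 : Fin n → Fin n → A := fun a b => ∑ cc, M2 a cc * Mup cc b
    let S : A := ∑ cc, sg (p cc) • M2 cc cc
    ∀ a e : Fin n,
      M3 a e = (ω - 1) • M2 a e + (2 - ω) • Mup a e + (ε / 2) • (Mup a e * S) -
        (ε / 2) • (if a = e then S else 0) := by
  intro ω Mlo Mup M2 M3 S a e
  let κ : Fin n → Fin n → ℂ := fun a b => ε * sg (p a * p b)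
  let g : Fin n → Fin n → ℂ := fun a b => sg (p a) * εlo a b
  let h : Fin n → Fin n → ℂ := fun a b => sg (p b) * εhi a b
  let D : Fin n → A := fun a => sg (p a) • d a
  have hεε : ε * ε = 1 := by rcases hε with rfl | rfl <;> norm_num
  have hlo : ∀ a b, εlo a b ≠ 0 → p a = p b := fun a b hab =>
    zmod_two_eq_of_add_eq_zero (not_not.mp fun hp => hab (hlo0 a b hp))
  have hhi : ∀ a b, εhi a b ≠ 0 → p a = p b := fun a b hab =>
    zmod_two_eq_of_add_eq_zero (not_not.mp fun hp => hab (hhi0 a b hp))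
  have hlo_sg : ∀ a b, sg (p a) * εlo a b = sg (p b) * εlo a b := fun a b => by
    by_cases hab : εlo a b = 0
    · simp [hab]
    · rw [hlo a b hab]
  have hhi_sg : ∀ a b, sg (p a) * εhi a b = sg (p b) * εhi a b := fun a b => by
    by_cases hab : εhi a b = 0
    · simp [hab]
    · rw [hhi a b hab]
  have H : ColorHeisenberg κ g h x D :=
    { sign_symm := fun a b => by simp only [κ, mul_comm (p a)]
      sign_mul_self := fun a b => by
        simp only [κ]
        linear_combination hεε * sg (p a * p b) * sg (p a * p b) + sg_mul_self (p a * p b)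
      metric_symm := fun a b => by
        simp only [κ, g]
        rw [hlo_sg a b, hlosym a b]; ring
      inv_symm := fun a b => by
        simp only [κ, h]
        rw [← hhi_sg a b, hhisym a b]; ring
      sign_eq := fun a b hab c => by
        simp only [κ, hhi a b (right_ne_zero_of_mul hab)]
      inv_metric := fun a c => by
        rw [← hinv1 a c]
        refine Finset.sum_congr rfl fun b _ => ?_
        linear_combination εhi a b * εlo b c * sg_mul_self (p b)
      metric_inv := fun a c => by
        rw [← hinv2 a c]
        refine Finset.sum_congr rfl fun b _ => ?_
        simp only [g, h]
        rw [hlo_sg, ← hhi_sg]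
        linear_combination εlo a b * εhi b c * sg_mul_self (p b)
      x_mul_x := hxx
      d_mul_d := fun a b => by
        simp only [κ, D, smul_mul_assoc, mul_smul_comm, hdd a b, smul_smul]
        congr 1; ring
      d_mul_x := fun a b => by
        simp only [κ, g, D, smul_mul_assoc, mul_smul_comm, sub_eq_iff_eq_add.mp (hdx a b)]
        module }
  have hω : ColorHeisenberg.dim g h = ω := by
    refine Finset.sum_congr rfl fun a _ => Finset.sum_congr rfl fun b _ => ?_
    simp only [g, h]
    rw [← hhi_sg]
    linear_combination εhi a b * εlo a b * sg_mul_self (p a)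
  have hup : ∀ a b, Mup a b = (sg (p a) * sg (p b)) • ColorHeisenberg.gen κ h x D a b :=
      fun a b => by
    simp only [Mup, Mlo, ColorHeisenberg.gen, ColorHeisenberg.raise, Finset.sum_mul, Finset.mul_sum,
      Finset.smul_sum, ← Finset.sum_sub_distrib]
    refine Finset.sum_congr rfl fun c _ => ?_
    by_cases hac : εhi a c = 0
    · simp [h, hac]
    · simp only [κ, h, D, sg_add, hhi a c hac, smul_mul_assoc, mul_smul_comm]
      match_scalars
      · linear_combination (-εhi a c) * sg_mul_self (p b) * (sg (p c) * sg (p c)) -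
          εhi a c * sg_mul_self (p c)
      · linear_combination εhi a c * ε * sg (p c * p b) * sg (p c) * sg (p b) *
          sg_mul_self (p c)
  have hM2 : ∀ a b, M2 a b = (sg (p a) * sg (p b)) • ColorHeisenberg.genSq κ h x D a b :=
      fun a b => by
    simp only [M2, ColorHeisenberg.genSq, Finset.smul_sum]
    refine Finset.sum_congr rfl fun c _ => ?_
    rw [hup, hup, smul_mul_assoc, mul_smul_comm, smul_smul]
    congr 1
    linear_combination sg (p a) * sg (p b) * sg_mul_self (p c)
  have hM3 : M3 a e = (sg (p a) * sg (p e)) •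
      ∑ c, ColorHeisenberg.genSq κ h x D a c * ColorHeisenberg.gen κ h x D c e := by
    simp only [M3, Finset.smul_sum]
    refine Finset.sum_congr rfl fun c _ => ?_
    rw [hup, hM2, smul_mul_assoc, mul_smul_comm, smul_smul]
    congr 1
    linear_combination sg (p a) * sg (p e) * sg_mul_self (p c)
  have hT : ε • S = ∑ c, κ c c • ColorHeisenberg.genSq κ h x D c c := by
    simp only [S, Finset.smul_sum]
    refine Finset.sum_congr rfl fun c _ => ?_
    rw [hM2, sg_mul_self, one_smul, smul_smul]
    simp only [κ, zmod_two_mul_self]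
  rw [hM3, H.sum_genSq_mul_gen hT, hω, hM2, hup]
  by_cases hae : a = e
  · subst hae
    simp only [if_true, sg_mul_self, mul_smul_comm, one_smul]
    module
  · simp only [if_neg hae, smul_zero, sub_zero, smul_mul_assoc, mul_smul_comm]
    module
end

section
/- With a supermetric and graded Heisenberg algebra as in the context, define M_{ab} := x_a ∂_b − ε(−1)^{[a][b]+[a]+[b]} x_b ∂_a. Then the graded symmetrized super-anticommutator condition holds: for all a, b, c, d ∈ I, {M_{bc}, M_{da}} + (−1)^{[d][c]+[d][b]+[b]+[c]}·{M_{db}, M_{ca}} + (−1)^{[b][c]+[b][d]+[c]+[d]}·{M_{cd}, M_{ba}} = 0, where for elements X = M_{pq} and Y = M_{rs} the super-anticommutator is {X, Y} := X·Y + (−1)^{([p]+[q])([r]+[s])}·Y·X. -/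
/-- Normal ordering of a product of two bilinears in a graded Heisenberg algebra. -/
theorem mul_mul_mul_normal_order {A : Type*} [Ring A] [Algebra ℂ A] {y z w v : A} {k l : ℂ}
    (h : z * w - k • (w * z) = l • (1 : A)) :
    y * z * (w * v) = l • (y * v) + k • (y * w * (z * v)) := by
  have h' : z * w = l • (1 : A) + k • (w * z) := by rw [← h]; abel
  calc y * z * (w * v) = y * (z * w) * v := by noncomm_ring
    _ = _ := by
      rw [h']
      simp only [mul_add, add_mul, mul_smul_comm, smul_mul_assoc, mul_one, mul_assoc]

/-- The Jordan–Schwinger generators M_{ab} satisfy the graded symmetrized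
super-anticommutator condition {M_{(bc}, M_{d)a}} = 0. -/
theorem jordan_schwinger_anticommutator_condition
    (n : ℕ) (p : Fin n → ZMod 2) (ε : ℂ) (hε : ε = 1 ∨ ε = -1)
    (εlo εhi : Matrix (Fin n) (Fin n) ℂ)
    (hlo0 : ∀ a b, p a + p b ≠ 0 → εlo a b = 0)
    (hhi0 : ∀ a b, p a + p b ≠ 0 → εhi a b = 0)
    (hlosym : ∀ a b, εlo a b = ε * sg (p a * p b) * εlo b a)
    (hhisym : ∀ a b, εhi a b = ε * sg (p a * p b) * εhi b a)
    (hinv1 : ∀ a c, (∑ b, εhi a b * εlo b c) = if a = c then 1 else 0)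
    (hinv2 : ∀ a c, (∑ b, εlo a b * εhi b c) = if a = c then 1 else 0)
    (A : Type*) [Ring A] [Algebra ℂ A] (x d : Fin n → A)
    (hxx : ∀ a b, x a * x b = (ε * sg (p a * p b)) • (x b * x a))
    (hdd : ∀ a b, d a * d b = (ε * sg (p a * p b)) • (d b * d a))
    (hdx : ∀ a b, d a * x b - (ε * sg (p a * p b)) • (x b * d a) = εlo a b • (1 : A)) :
    let Mlo : Fin n → Fin n → A := fun a b =>
      x a * d b - (ε * sg (p a * p b + p a + p b)) • (x b * d a)
    let acomm : Fin n → Fin n → Fin n → Fin n → A := fun q r s t =>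
      Mlo q r * Mlo s t + sg ((p q + p r) * (p s + p t)) • (Mlo s t * Mlo q r)
    ∀ a b c e : Fin n,
      acomm b c e a + sg (p e * p c + p e * p b + p b + p c) • acomm e b c a +
        sg (p b * p c + p b * p e + p c + p e) • acomm c e b a = 0 := by
  intro Mlo acomm a b c e
  have key (i j k l : Fin n) : x i * d j * (x k * d l) =
      εlo j k • (x i * d l) + (ε * sg (p j * p k)) • (x i * x k * (d j * d l)) :=
    mul_mul_mul_normal_order (hdx j k)
  simp only [acomm, Mlo, sub_mul, mul_sub, smul_mul_assoc, mul_smul_comm, key]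
  rw [hxx b a, hxx c a, hxx e a, hxx c b, hxx e b, hxx e c,
    hdd b a, hdd c a, hdd e a, hdd c b, hdd e b, hdd e c,
    hlosym b a, hlosym c a, hlosym e a, hlosym c b, hlosym e b, hlosym e c]
  simp only [smul_mul_assoc, mul_smul_comm]
  have hpar : ∀ y : ZMod 2, y = 0 ∨ y = 1 := by decide
  have hab := hlo0 a b
  have hac := hlo0 a c
  have hae := hlo0 a e
  have hbc := hlo0 b c
  have hbe := hlo0 b e
  have hce := hlo0 c e
  rcases hpar (p a) with ha | ha <;> rcases hpar (p b) with hb | hb <;>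
    rcases hpar (p c) with hc | hc <;> rcases hpar (p e) with he | he <;>
    simp only [ha, hb, hc, he, sg, add_zero, zero_add, mul_zero, mul_one,
      show (1 : ZMod 2) + 1 = 0 from rfl, if_true, one_ne_zero, if_false, ne_eq,
      not_true_eq_false, not_false_eq_true, true_imp_iff, false_imp_iff]
      at hab hac hae hbc hbe hce ⊢ <;>
    (try simp only [hab, hac, hae, hbc, hbe, hce, zero_smul, mul_zero, zero_add]) <;>
    rcases hε with rfl | rfl <;> module
end
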